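/- arXiv:1705.01797 — 9 statements merged into one kernel-verified Lean document; each statement's English description precedes it below -/
import Mathlib

section
/- Let x* ∈ Ω be a point with q_{F(x*)} ≠ 0. Then x* is a stationary point of the problem min f(x) subject to x ∈ Ω if and only if h_i(x*) = 0 for every i ∈ F(x*), h_i(x*) ≥ 0 for every i ∈ A_l(x*), and h_i(x*) ≤ 0 for every i ∈ A_u(x*). -/
noncomputable section

open Matrix
open scoped Classical

/-- Euclidean dot product. -/
def dotp {m : Type*} [Fintype m] (v w : m → ℝ) : ℝ := ∑ i, v i * w i

/-- Euclidean norm. -/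
def nrm {m : Type*} [Fintype m] (v : m → ℝ) : ℝ := Real.sqrt (∑ i, (v i) ^ 2)

/-- Objective f(x) = ½ xᵀHx − cᵀx. -/
def fObj {n : ℕ} (H : Matrix (Fin n) (Fin n) ℝ) (c x : Fin n → ℝ) : ℝ :=
  (1 / 2) * dotp x (H.mulVec x) - dotp c x

/-- Gradient ∇f(x) = Hx − c (for H symmetric). -/
def grad {n : ℕ} (H : Matrix (Fin n) (Fin n) ℝ) (c x : Fin n → ℝ) : Fin n → ℝ :=
  H.mulVec x - c

/-- Feasible set Ω = {x : qᵀx = b, l ≤ x ≤ u}. -/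
def OmegaSet {n : ℕ} (q : Fin n → ℝ) (b : ℝ) (l u : Fin n → ℝ) : Set (Fin n → ℝ) :=
  {x | dotp q x = b ∧ ∀ i, l i ≤ x i ∧ x i ≤ u i}

/-- Lower active set A_l(x). -/
def Al {n : ℕ} (l x : Fin n → ℝ) : Set (Fin n) := {i | x i = l i}

/-- Upper active set A_u(x). -/
def Au {n : ℕ} (u x : Fin n → ℝ) : Set (Fin n) := {i | x i = u i}

/-- Active set A(x). -/
def ASet {n : ℕ} (l u x : Fin n → ℝ) : Set (Fin n) := Al l x ∪ Au u x

/-- Free set F(x). -/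
def FSet {n : ℕ} (l u x : Fin n → ℝ) : Set (Fin n) := (ASet l u x)ᶜ

/-- ρ(x) = q_Fᵀ(∇f(x))_F / q_Fᵀq_F (0 if q_F = 0). -/
def rhoF {n : ℕ} (H : Matrix (Fin n) (Fin n) ℝ) (c q l u x : Fin n → ℝ) : ℝ :=
  if ∀ i ∈ FSet l u x, q i = 0 then 0
  else (∑ i, if i ∈ FSet l u x then q i * grad H c x i else 0) /
    (∑ i, if i ∈ FSet l u x then q i * q i else 0)

/-- h(x) = ∇f(x) − ρ(x) q. -/
def hVec {n : ℕ} (H : Matrix (Fin n) (Fin n) ℝ) (c q l u x : Fin n → ℝ) : Fin n → ℝ :=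
  fun i => grad H c x i - rhoF H c q l u x * q i

/-- Free gradient φ(x). -/
def phiVec {n : ℕ} (H : Matrix (Fin n) (Fin n) ℝ) (c q l u x : Fin n → ℝ) : Fin n → ℝ :=
  fun i => if i ∈ FSet l u x then hVec H c q l u x i else 0

/-- Tangent cone T_Ω(x). -/
def TCone {n : ℕ} (q l u x : Fin n → ℝ) : Set (Fin n → ℝ) :=
  {v | dotp q v = 0 ∧ (∀ i ∈ Al l x, 0 ≤ v i) ∧ (∀ i ∈ Au u x, v i ≤ 0)}

/-- g is the projected gradient ∇_Ω f(x): the minimizer of ‖v + ∇f(x)‖ over v ∈ T_Ω(x). -/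
def IsProjGrad {n : ℕ} (H : Matrix (Fin n) (Fin n) ℝ) (c q l u x g : Fin n → ℝ) : Prop :=
  g ∈ TCone q l u x ∧ ∀ v ∈ TCone q l u x, nrm (g + grad H c x) ≤ nrm (v + grad H c x)

/-- Chopped gradient β(x) = −∇_Ω f(x) − φ(x), where g = ∇_Ω f(x). -/
def betaVec {n : ℕ} (H : Matrix (Fin n) (Fin n) ℝ) (c q l u x g : Fin n → ℝ) : Fin n → ℝ :=
  -g - phiVec H c q l u x

/-- Binding set B(x). -/
def BSet {n : ℕ} (H : Matrix (Fin n) (Fin n) ℝ) (c q l u x : Fin n → ℝ) : Set (Fin n) :=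
  {i | (i ∈ Al l x ∧ 0 ≤ hVec H c q l u x i) ∨ (i ∈ Au u x ∧ hVec H c q l u x i ≤ 0)}

/-- Affine closure Ω(x) of the face determined by the active set at x. -/
def OmegaFace {n : ℕ} (q : Fin n → ℝ) (b : ℝ) (l u x : Fin n → ℝ) : Set (Fin n → ℝ) :=
  {v | dotp q v = b ∧ ∀ i ∈ ASet l u x, v i = x i}

/-- Ω₀(x). -/
def Omega0 {n : ℕ} (q l u x : Fin n → ℝ) : Set (Fin n → ℝ) :=
  {v | dotp q v = 0 ∧ ∀ i ∈ ASet l u x, v i = 0}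

/-- KKT stationarity: ∇f(x) = Σ_{i∈A(x)} λᵢ eᵢ + ρ q with sign conditions. -/
def Stationary {n : ℕ} (H : Matrix (Fin n) (Fin n) ℝ) (c q : Fin n → ℝ) (b : ℝ)
    (l u x : Fin n → ℝ) : Prop :=
  x ∈ OmegaSet q b l u ∧
    ∃ (ρs : ℝ) (lam : Fin n → ℝ),
      (∀ i, grad H c x i = lam i + ρs * q i) ∧
      (∀ i ∈ FSet l u x, lam i = 0) ∧
      (∀ i ∈ Al l x, 0 ≤ lam i) ∧ (∀ i ∈ Au u x, lam i ≤ 0)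

/-- Lagrange multiplier estimate λ(x). -/
def lamEst {n : ℕ} (H : Matrix (Fin n) (Fin n) ℝ) (c q l u x : Fin n → ℝ) : Fin n → ℝ :=
  fun i =>
    if i ∈ Al l x then max 0 (hVec H c q l u x i)
    else if i ∈ Au u x then min 0 (hVec H c q l u x i) else 0

/-- ζ is the smallest eigenvalue of M. -/
def IsSmallestEigenvalue {m : Type*} [Fintype m] (M : Matrix m m ℝ) (ζ : ℝ) : Prop :=
  (∃ v : m → ℝ, v ≠ 0 ∧ M.mulVec v = ζ • v) ∧
    ∀ (μ : ℝ) (v : m → ℝ), v ≠ 0 → M.mulVec v = μ • v → ζ ≤ μ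

/-- ζ is the largest eigenvalue of M. -/
def IsLargestEigenvalue {m : Type*} [Fintype m] (M : Matrix m m ℝ) (ζ : ℝ) : Prop :=
  (∃ v : m → ℝ, v ≠ 0 ∧ M.mulVec v = ζ • v) ∧
    ∀ (μ : ℝ) (v : m → ℝ), v ≠ 0 → M.mulVec v = μ • v → μ ≤ ζ

/-- t is the spectral (ℓ₂ operator) norm of M. -/
def IsSpectralNorm {m k : Type*} [Fintype m] [Fintype k] (M : Matrix m k ℝ) (t : ℝ) : Prop :=
  IsLeast {s : ℝ | 0 ≤ s ∧ ∀ v : k → ℝ, nrm (M.mulVec v) ≤ s * nrm v} t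

/-- If the free gradient is a multiple `r` of `q` on the free set and `q` does not vanish there,
then the multiplier estimate `ρ(x)` equals `r`. -/
theorem rhoF_eq_of_grad_eq_mul {n : ℕ} {H : Matrix (Fin n) (Fin n) ℝ} {c q l u x : Fin n → ℝ}
    {r : ℝ} (hq : ∃ i ∈ FSet l u x, q i ≠ 0)
    (hr : ∀ i ∈ FSet l u x, grad H c x i = r * q i) :
    rhoF H c q l u x = r := by
  have hpos : 0 < ∑ i, if i ∈ FSet l u x then q i * q i else 0 := by
    obtain ⟨j, hj, hqj⟩ := hq
    refine Finset.sum_pos' (fun i _ => ?_) ⟨j, Finset.mem_univ j, ?_⟩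
    · split_ifs
      · exact mul_self_nonneg _
      · exact le_rfl
    · rw [if_pos hj]
      exact mul_self_pos.mpr hqj
  rw [rhoF, if_neg (by push Not; exact hq), div_eq_iff hpos.ne', Finset.mul_sum]
  refine Finset.sum_congr rfl fun i _ => ?_
  split_ifs with hi
  · rw [hr i hi]
    ring
  · rw [mul_zero]

/-- For x* ∈ Ω with q_{F(x*)} ≠ 0, x* is stationary iff
h_i(x*) = 0 on F(x*), h_i(x*) ≥ 0 on A_l(x*), h_i(x*) ≤ 0 on A_u(x*). -/
theorem stmt_0 {n : ℕ} (hn : 1 ≤ n)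
    (H : Matrix (Fin n) (Fin n) ℝ) (hH : H.IsSymm)
    (c q l u : Fin n → ℝ) (b : ℝ) (hlu : ∀ i, l i < u i)
    (xs : Fin n → ℝ) (hxs : xs ∈ OmegaSet q b l u)
    (hqF : ∃ i ∈ FSet l u xs, q i ≠ 0) :
    Stationary H c q b l u xs ↔
      (∀ i ∈ FSet l u xs, hVec H c q l u xs i = 0) ∧
        (∀ i ∈ Al l xs, 0 ≤ hVec H c q l u xs i) ∧
        (∀ i ∈ Au u xs, hVec H c q l u xs i ≤ 0) := by
  constructor
  · rintro ⟨-, r, lam, hgrad, hF, hl, hu⟩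
    have hrho : rhoF H c q l u xs = r :=
      rhoF_eq_of_grad_eq_mul hqF fun i hi => by rw [hgrad i, hF i hi, zero_add]
    have hlam : hVec H c q l u xs = lam := by
      funext i
      rw [hVec, hrho, hgrad i, add_sub_cancel_right]
    rw [hlam]
    exact ⟨hF, hl, hu⟩
  · intro h
    exact ⟨hxs, rhoF H c q l u xs, hVec H c q l u xs,
      fun i => (sub_add_cancel _ _).symm, h⟩
end
end

section
/- Let {x^k} be a sequence in Ω converging to a stationary point x* with q_{F(x*)} ≠ 0 and with all Lagrange multipliers λ_i*, i ∈ A(x*), nonzero (nondegeneracy), and suppose A_l(x^k) = A_l(x*) and A_u(x^k) = A_u(x*) for all sufficiently large k. Define λ_i(x) = max{0, h_i(x)} if i ∈ A_l(x), λ_i(x) = min{0, h_i(x)} if i ∈ A_u(x), and λ_i(x) = 0 if i ∈ F(x). Then ρ(x^k) → ρ* and λ_i(x^k) → λ_i* for every i ∈ A(x*), where ρ* and λ_i* are the (unique) Lagrange multipliers of x*. -/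
noncomputable section

open Matrix
open scoped Classical

theorem continuous_grad {n : ℕ} (H : Matrix (Fin n) (Fin n) ℝ) (c : Fin n → ℝ) :
    Continuous (grad H c) := by
  unfold grad
  fun_prop

/-- With the free set frozen, `rhoF` agrees with a fixed continuous function. -/
theorem rhoF_eq_of_FSet_eq {n : ℕ} (H : Matrix (Fin n) (Fin n) ℝ) (c q l u : Fin n → ℝ)
    {x y : Fin n → ℝ} (hF : FSet l u x = FSet l u y) (hq : ∃ i ∈ FSet l u y, q i ≠ 0) :
    rhoF H c q l u x =
      (∑ i, if i ∈ FSet l u y then q i * grad H c x i else 0) /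
        (∑ i, if i ∈ FSet l u y then q i * q i else 0) := by
  unfold rhoF
  rw [hF, if_neg]
  push Not
  exact hq

/-- If the gradient is a multiple `r` of `q` on the free set, then `rhoF` equals `r`. -/
theorem rhoF_eq_multiplier {n : ℕ} (H : Matrix (Fin n) (Fin n) ℝ) (c q l u : Fin n → ℝ)
    {x : Fin n → ℝ} {r : ℝ} (hq : ∃ i ∈ FSet l u x, q i ≠ 0)
    (hr : ∀ i ∈ FSet l u x, grad H c x i = r * q i) :
    rhoF H c q l u x = r := by
  obtain ⟨j, hj, hqj⟩ := hq
  have hpos : 0 < ∑ i, if i ∈ FSet l u x then q i * q i else 0 := by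
    refine Finset.sum_pos' (fun i _ => ?_) ⟨j, Finset.mem_univ j, ?_⟩
    · split_ifs
      exacts [mul_self_nonneg _, le_rfl]
    · rw [if_pos hj]
      exact mul_self_pos.mpr hqj
  rw [rhoF_eq_of_FSet_eq H c q l u rfl ⟨j, hj, hqj⟩, div_eq_iff hpos.ne', Finset.mul_sum]
  refine Finset.sum_congr rfl fun i _ => ?_
  split_ifs with hi
  · rw [hr i hi]
    ring
  · ring

theorem tendsto_rhoF {n : ℕ} (H : Matrix (Fin n) (Fin n) ℝ) (c q l u : Fin n → ℝ)
    {ι : Type*} {L : Filter ι} {y : ι → Fin n → ℝ} {x : Fin n → ℝ}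
    (hy : Filter.Tendsto y L (nhds x)) (hF : ∀ᶠ k in L, FSet l u (y k) = FSet l u x)
    (hq : ∃ i ∈ FSet l u x, q i ≠ 0) :
    Filter.Tendsto (fun k => rhoF H c q l u (y k)) L (nhds (rhoF H c q l u x)) := by
  rw [rhoF_eq_of_FSet_eq H c q l u rfl hq]
  refine Filter.Tendsto.congr'
    (hF.mono fun k hk => (rhoF_eq_of_FSet_eq H c q l u hk hq).symm) ?_
  refine Filter.Tendsto.div_const (tendsto_finsetSum _ fun i _ => ?_) _
  split_ifs
  · exact ((((continuous_apply i).comp (continuous_grad H c)).tendsto x).comp hy).const_mul (q i)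
  · exact tendsto_const_nhds

/-- consistency of the Lagrange multiplier estimates ρ(x^k), λ(x^k). -/
theorem stmt_1 {n : ℕ} (hn : 1 ≤ n)
    (H : Matrix (Fin n) (Fin n) ℝ) (hH : H.IsSymm)
    (c q l u : Fin n → ℝ) (b : ℝ) (hlu : ∀ i, l i < u i)
    (xk : ℕ → Fin n → ℝ) (hxk : ∀ k, xk k ∈ OmegaSet q b l u)
    (xs : Fin n → ℝ) (hxs : xs ∈ OmegaSet q b l u)
    (hconv : Filter.Tendsto xk Filter.atTop (nhds xs))
    (hqF : ∃ i ∈ FSet l u xs, q i ≠ 0)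
    -- x* is stationary with (unique) multipliers ρs and lam
    (ρs : ℝ) (lam : Fin n → ℝ)
    (hkkt : ∀ i, grad H c xs i = lam i + ρs * q i)
    (hsupp : ∀ i ∈ FSet l u xs, lam i = 0)
    (hsl : ∀ i ∈ Al l xs, 0 ≤ lam i)
    (hsu : ∀ i ∈ Au u xs, lam i ≤ 0)
    -- nondegeneracy
    (hnondeg : ∀ i ∈ ASet l u xs, lam i ≠ 0)
    -- A_l(x^k) = A_l(x*) and A_u(x^k) = A_u(x*) for all k sufficiently large
    (hAeq : ∃ K, ∀ k ≥ K, Al l (xk k) = Al l xs ∧ Au u (xk k) = Au u xs) :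
    Filter.Tendsto (fun k => rhoF H c q l u (xk k)) Filter.atTop (nhds ρs) ∧
      ∀ i ∈ ASet l u xs,
        Filter.Tendsto (fun k => lamEst H c q l u (xk k) i) Filter.atTop (nhds (lam i)) := by
  obtain ⟨K, hK⟩ := hAeq
  have hA : ∀ᶠ k in Filter.atTop, Al l (xk k) = Al l xs ∧ Au u (xk k) = Au u xs :=
    Filter.eventually_atTop.mpr ⟨K, hK⟩
  have hρ : Filter.Tendsto (fun k => rhoF H c q l u (xk k)) Filter.atTop (nhds ρs) := by
    have hρs : rhoF H c q l u xs = ρs :=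
      rhoF_eq_multiplier H c q l u hqF fun i hi => by rw [hkkt i, hsupp i hi, zero_add]
    rw [← hρs]
    refine tendsto_rhoF H c q l u hconv (hA.mono fun k hk => ?_) hqF
    rw [FSet, FSet, ASet, ASet, hk.1, hk.2]
  refine ⟨hρ, fun i hi => ?_⟩
  have hh : Filter.Tendsto (fun k => hVec H c q l u (xk k) i) Filter.atTop (nhds (lam i)) := by
    have hlim : lam i = grad H c xs i - ρs * q i := by rw [hkkt i, add_sub_cancel_right]
    rw [hlim]
    exact ((((continuous_apply i).comp (continuous_grad H c)).tendsto xs).comp hconv).sub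
      (hρ.mul_const (q i))
  by_cases hil : i ∈ Al l xs
  · rw [← max_eq_right (hsl i hil)]
    refine Filter.Tendsto.congr' (hA.mono fun k hk => ?_) (tendsto_const_nhds.max hh)
    simp only [lamEst, hk.1, if_pos hil]
  · have hiu : i ∈ Au u xs := hi.resolve_left hil
    rw [← min_eq_right (hsu i hiu)]
    refine Filter.Tendsto.congr' (hA.mono fun k hk => ?_) (tendsto_const_nhds.min hh)
    simp only [lamEst, hk.1, hk.2, if_neg hil, if_pos hiu]
end
end

section
/- Let {x^k} be a sequence in Ω converging to a point x*, and assume ‖∇_Ω f(x^k)‖ → 0 as k → ∞. Then x* is a stationary point of the problem min f(x) subject to x ∈ Ω. -/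
noncomputable section

open Matrix
open scoped Classical

lemma exists_mul_le_of_finite {ι : Type*} [Finite ι] (a p : ι → ℝ)
    (hzero : ∀ i, p i = 0 → 0 ≤ a i)
    (hpair : ∀ i j, 0 < p i → p j < 0 → 0 ≤ -p j * a i + p i * a j) :
    ∃ ρ : ℝ, ∀ i, ρ * p i ≤ a i := by
  set L : Set ℝ := (fun i => a i / p i) '' {i | p i < 0}
  set U : Set ℝ := (fun i => a i / p i) '' {i | 0 < p i}
  have hL : L.Finite := (Set.toFinite _).image _
  have hU : U.Finite := (Set.toFinite _).image _
  have hLU : ∀ x ∈ L, ∀ y ∈ U, x ≤ y := by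
    rintro _ ⟨j, hj, rfl⟩ _ ⟨i, hi, rfl⟩
    have hj' : p j < 0 := hj
    have hi' : 0 < p i := hi
    have h := hpair i j hi' hj'
    change a j / p j ≤ a i / p i
    rw [div_le_iff_of_neg hj', div_mul_eq_mul_div, div_le_iff₀ hi']
    linarith
  obtain ⟨ρ, hρL, hρU⟩ : ∃ ρ, ρ ∈ upperBounds L ∧ ρ ∈ lowerBounds U := by
    rcases L.eq_empty_or_nonempty with h | h
    · obtain ⟨ρ, hρ⟩ := hU.bddBelow
      exact ⟨ρ, by simp [h], hρ⟩
    · exact ⟨sSup L, fun x hx => le_csSup hL.bddAbove hx,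
        fun y hy => csSup_le h fun x hx => hLU x hx y hy⟩
  refine ⟨ρ, fun i => ?_⟩
  rcases lt_trichotomy (p i) 0 with h | h | h
  · exact (div_le_iff_of_neg h).1 (hρL ⟨i, h, rfl⟩)
  · simpa [h] using hzero i h
  · exact (le_div_iff₀ h).1 (hρU ⟨i, h, rfl⟩)

lemma dotp_add_right {m : Type*} [Fintype m] (w v v' : m → ℝ) :
    dotp w (v + v') = dotp w v + dotp w v' := by
  simp [dotp, mul_add, Finset.sum_add_distrib]

lemma dotp_smul_right {m : Type*} [Fintype m] (w v : m → ℝ) (t : ℝ) :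
    dotp w (t • v) = t * dotp w v := by
  simp [dotp, Finset.mul_sum, mul_left_comm]

lemma dotp_sub_right {m : Type*} [Fintype m] (w v v' : m → ℝ) :
    dotp w (v - v') = dotp w v - dotp w v' := by
  simp [dotp, mul_sub, Finset.sum_sub_distrib]

lemma dotp_single {m : Type*} [Fintype m] [DecidableEq m] (w : m → ℝ) (i : m) (t : ℝ) :
    dotp w (Pi.single i t) = w i * t := by
  simp [dotp, Pi.single_apply]

lemma continuous_dotp {m : Type*} [Fintype m] :
    Continuous fun z : (m → ℝ) × (m → ℝ) => dotp z.1 z.2 := by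
  unfold dotp
  fun_prop

lemma abs_apply_le_nrm {m : Type*} [Fintype m] (v : m → ℝ) (i : m) : |v i| ≤ nrm v :=
  Real.abs_le_sqrt
    (Finset.single_le_sum (f := fun j => v j ^ 2) (fun _ _ => sq_nonneg _) (Finset.mem_univ i))

lemma TCone.add_smul_mem {n : ℕ} {q l u x v w : Fin n → ℝ} (hv : v ∈ TCone q l u x)
    (hw : w ∈ TCone q l u x) {t : ℝ} (ht : 0 ≤ t) : v + t • w ∈ TCone q l u x := by
  refine ⟨?_, fun i hi => ?_, fun i hi => ?_⟩
  · rw [dotp_add_right, dotp_smul_right, hv.1, hw.1]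
    ring
  · exact add_nonneg (hv.2.1 i hi) (mul_nonneg ht (hw.2.1 i hi))
  · exact add_nonpos (hv.2.2 i hi) (mul_nonpos_of_nonneg_of_nonpos ht (hw.2.2 i hi))

lemma sub_mem_TCone {n : ℕ} {q l u x y : Fin n → ℝ} {b : ℝ} (hx : x ∈ OmegaSet q b l u)
    (hy : y ∈ OmegaSet q b l u) : y - x ∈ TCone q l u x := by
  refine ⟨?_, fun i hi => ?_, fun i hi => ?_⟩
  · rw [dotp_sub_right, hx.1, hy.1, sub_self]
  · have hi' : x i = l i := hi
    simpa [hi'] using (hy.2 i).1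
  · have hi' : x i = u i := hi
    simpa [hi'] using (hy.2 i).2

/-- A minimal-norm point along a ray satisfies the first-order inequality. -/
lemma dotp_nonneg_of_nrm_le {m : Type*} [Fintype m] {w v : m → ℝ}
    (h : ∀ t : ℝ, 0 < t → nrm w ≤ nrm (w + t • v)) : 0 ≤ dotp w v := by
  by_contra! hD
  have hV : 0 ≤ ∑ i, v i ^ 2 := Finset.sum_nonneg fun i _ => sq_nonneg _
  have key : ∀ t : ℝ, 0 < t → 0 ≤ 2 * dotp w v + t * ∑ i, v i ^ 2 := by
    intro t ht
    have h1 := (Real.sqrt_le_sqrt_iff (Finset.sum_nonneg fun i _ => sq_nonneg _)).1 (h t ht)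
    have h2 : ∑ i, (w + t • v) i ^ 2
        = ∑ i, w i ^ 2 + t * (2 * dotp w v + t * ∑ i, v i ^ 2) := by
      simp only [dotp, Finset.mul_sum, ← Finset.sum_add_distrib]
      refine Finset.sum_congr rfl fun i _ => ?_
      simp only [Pi.add_apply, Pi.smul_apply, smul_eq_mul]
      ring
    rw [h2] at h1
    exact nonneg_of_mul_nonneg_right (by linarith) ht
  have h3 := key (-dotp w v / (∑ i, v i ^ 2 + 1)) (div_pos (by linarith) (by linarith))
  have h4 : -dotp w v / (∑ i, v i ^ 2 + 1) * ∑ i, v i ^ 2 ≤ -dotp w v := by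
    rw [div_mul_eq_mul_div, div_le_iff₀ (by linarith)]
    nlinarith
  linarith

lemma IsProjGrad.dotp_nonneg {n : ℕ} {H : Matrix (Fin n) (Fin n) ℝ} {c q l u x g v : Fin n → ℝ}
    (hg : IsProjGrad H c q l u x g) (hv : v ∈ TCone q l u x) :
    0 ≤ dotp (g + grad H c x) v := by
  refine dotp_nonneg_of_nrm_le fun t ht => ?_
  have := hg.2 _ (TCone.add_smul_mem hg.1 hv ht.le)
  rwa [add_right_comm] at this

lemma isClosed_OmegaSet {n : ℕ} (q l u : Fin n → ℝ) (b : ℝ) : IsClosed (OmegaSet q b l u) := by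
  have h : Continuous fun x : Fin n → ℝ => dotp q x := by
    unfold dotp
    fun_prop
  have hbox : OmegaSet q b l u = {x | dotp q x = b} ∩ Set.Icc l u := by
    ext x
    exact and_congr_right fun _ => forall_and
  rw [hbox]
  exact (isClosed_eq h continuous_const).inter isClosed_Icc

/-- Tangent directions of the polyhedron `Ω` are feasible directions. -/
lemma exists_pos_add_smul_mem_OmegaSet {n : ℕ} {q l u x v : Fin n → ℝ} {b : ℝ}
    (hx : x ∈ OmegaSet q b l u) (hv : v ∈ TCone q l u x) :
    ∃ t : ℝ, 0 < t ∧ x + t • v ∈ OmegaSet q b l u := by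
  have hcont : ∀ i, Filter.Tendsto (fun t : ℝ => x i + t * v i)
      (nhdsWithin 0 (Set.Ioi 0)) (nhds (x i)) := by
    intro i
    have : Continuous fun t : ℝ => x i + t * v i := by fun_prop
    simpa using (this.tendsto 0).mono_left nhdsWithin_le_nhds
  have hpos : ∀ᶠ t : ℝ in nhdsWithin 0 (Set.Ioi 0), 0 < t := self_mem_nhdsWithin
  have hev : ∀ᶠ t : ℝ in nhdsWithin 0 (Set.Ioi 0),
      ∀ i, l i ≤ x i + t * v i ∧ x i + t * v i ≤ u i := by
    rw [Filter.eventually_all]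
    intro i
    refine Filter.Eventually.and ?_ ?_
    · rcases (hx.2 i).1.eq_or_lt with h | h
      · filter_upwards [hpos] with t ht
        have := mul_nonneg ht.le (hv.2.1 i h.symm)
        linarith
      · exact ((hcont i).eventually (lt_mem_nhds h)).mono fun t ht => ht.le
    · rcases (hx.2 i).2.eq_or_lt with h | h
      · filter_upwards [hpos] with t ht
        have := mul_nonpos_of_nonneg_of_nonpos ht.le (hv.2.2 i h)
        linarith
      · exact ((hcont i).eventually (gt_mem_nhds h)).mono fun t ht => ht.le
  obtain ⟨t, ht, hbox⟩ := (hpos.and hev).exists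
  refine ⟨t, ht, ?_, hbox⟩
  rw [dotp_add_right, dotp_smul_right, hx.1, hv.1]
  ring

/-- The KKT conditions follow from the primal variational inequality on the tangent cone. -/
lemma stationary_of_dotp_grad_nonneg {n : ℕ} {H : Matrix (Fin n) (Fin n) ℝ}
    {c q l u x : Fin n → ℝ} {b : ℝ} (hlu : ∀ i, l i < u i) (hx : x ∈ OmegaSet q b l u)
    (hvar : ∀ v ∈ TCone q l u x, 0 ≤ dotp (grad H c x) v) : Stationary H c q b l u x := by
  let d : {i // i ∉ Au u x} ⊕ {i // i ∉ Al l x} → Fin n → ℝ :=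
    Sum.elim (fun i => Pi.single i.1 1) (fun i => Pi.single i.1 (-1))
  have hdl : ∀ s, ∀ i ∈ Al l x, 0 ≤ d s i := by
    rintro (⟨j, hj⟩ | ⟨j, hj⟩) i hi
    · simp only [d, Sum.elim_inl, Pi.single_apply]
      split_ifs <;> norm_num
    · have hij : i ≠ j := fun h => hj (h ▸ hi)
      simp [d, hij]
  have hdu : ∀ s, ∀ i ∈ Au u x, d s i ≤ 0 := by
    rintro (⟨j, hj⟩ | ⟨j, hj⟩) i hi
    · have hij : i ≠ j := fun h => hj (h ▸ hi)
      simp [d, hij]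
    · simp only [d, Sum.elim_inr, Pi.single_apply]
      split_ifs <;> norm_num
  obtain ⟨ρ, hρ⟩ := exists_mul_le_of_finite (fun s => dotp (grad H c x) (d s))
    (fun s => dotp q (d s)) (fun s hs => hvar _ ⟨hs, hdl s, hdu s⟩) (by
      intro s s' hs hs'
      have hs0 : 0 ≤ -dotp q (d s') := by linarith
      rw [← dotp_smul_right, ← dotp_smul_right, ← dotp_add_right]
      refine hvar _ ⟨?_, fun i hi => ?_, fun i hi => ?_⟩
      · rw [dotp_add_right, dotp_smul_right, dotp_smul_right]
        ring
      · exact add_nonneg (mul_nonneg hs0 (hdl s i hi)) (mul_nonneg hs.le (hdl s' i hi))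
      · exact add_nonpos (mul_nonpos_of_nonneg_of_nonpos hs0 (hdu s i hi))
          (mul_nonpos_of_nonneg_of_nonpos hs.le (hdu s' i hi)))
  have hge : ∀ i, i ∉ Au u x → 0 ≤ grad H c x i - ρ * q i := by
    intro i hi
    have := hρ (Sum.inl ⟨i, hi⟩)
    simp only [d, Sum.elim_inl, dotp_single] at this
    linarith
  have hle : ∀ i, i ∉ Al l x → grad H c x i - ρ * q i ≤ 0 := by
    intro i hi
    have := hρ (Sum.inr ⟨i, hi⟩)
    simp only [d, Sum.elim_inr, dotp_single] at this
    linarith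
  have hdisj : ∀ i ∈ Al l x, i ∉ Au u x := fun i (hl : x i = l i) (hu : x i = u i) =>
    (hlu i).ne (hl.symm.trans hu)
  exact ⟨hx, ρ, fun i => grad H c x i - ρ * q i, fun i => by ring,
    fun i hi => le_antisymm (hle i fun h => hi (Or.inl h)) (hge i fun h => hi (Or.inr h)),
    fun i hi => hge i (hdisj i hi), fun i hi => hle i fun h => hdisj i h hi⟩

/-- if x^k ∈ Ω, x^k → x*, and ‖∇_Ω f(x^k)‖ → 0, then x* is stationary. -/
theorem stmt_2 {n : ℕ} (hn : 1 ≤ n)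
    (H : Matrix (Fin n) (Fin n) ℝ) (hH : H.IsSymm)
    (c q l u : Fin n → ℝ) (b : ℝ) (hlu : ∀ i, l i < u i)
    (xk : ℕ → Fin n → ℝ) (hxk : ∀ k, xk k ∈ OmegaSet q b l u)
    (xs : Fin n → ℝ)
    (hconv : Filter.Tendsto xk Filter.atTop (nhds xs))
    (gP : ℕ → Fin n → ℝ)
    (hgP : ∀ k, IsProjGrad H c q l u (xk k) (gP k))
    (hgconv : Filter.Tendsto (fun k => nrm (gP k)) Filter.atTop (nhds 0)) :
    Stationary H c q b l u xs := by
  have hxs : xs ∈ OmegaSet q b l u :=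
    (isClosed_OmegaSet q l u b).mem_of_tendsto hconv (Filter.Eventually.of_forall hxk)
  have hg0 : Filter.Tendsto gP Filter.atTop (nhds 0) := by
    rw [tendsto_pi_nhds]
    exact fun i => squeeze_zero_norm (fun k => abs_apply_le_nrm (gP k) i) hgconv
  have hgrad : Continuous fun x => grad H c x := by
    unfold grad
    fun_prop
  have hvar : ∀ y ∈ OmegaSet q b l u, 0 ≤ dotp (grad H c xs) (y - xs) := by
    intro y hy
    have hsum := hg0.add ((hgrad.tendsto xs).comp hconv)
    rw [zero_add] at hsum
    have hlim := (continuous_dotp.tendsto _).comp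
      (hsum.prodMk_nhds (hconv.const_sub y))
    exact ge_of_tendsto' hlim fun k => (hgP k).dotp_nonneg (sub_mem_TCone (hxk k) hy)
  refine stationary_of_dotp_grad_nonneg hlu hxs fun v hv => ?_
  obtain ⟨t, ht, hmem⟩ := exists_pos_add_smul_mem_OmegaSet hxs hv
  have h := hvar _ hmem
  rw [add_sub_cancel_left, dotp_smul_right] at h
  exact nonneg_of_mul_nonneg_right h ht
end
end

section
/- Let x ∈ Ω. Then φ(x) = 0 if and only if x is a stationary point of the problem min f(u) subject to u ∈ Ω(x), i.e., if and only if ∇f(x) lies in the linear span of {q} ∪ {e_i : i ∈ A(x)}. -/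
noncomputable section

open Matrix
open scoped Classical

/-- If `q` does not vanish on the free set and `∇f(x) = γ q` there, then `ρ(x) = γ`. -/
lemma rhoF_eq_of_grad_eq {n : ℕ} (H : Matrix (Fin n) (Fin n) ℝ) (c q l u x : Fin n → ℝ)
    {γ : ℝ} (hq : ¬ ∀ i ∈ FSet l u x, q i = 0)
    (hgrad : ∀ i ∈ FSet l u x, grad H c x i = γ * q i) :
    rhoF H c q l u x = γ := by
  have hpos : 0 < ∑ i, if i ∈ FSet l u x then q i * q i else 0 := by
    obtain ⟨j, hj, hqj⟩ : ∃ j ∈ FSet l u x, q j ≠ 0 := by simpa using hq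
    refine Finset.sum_pos' (fun i _ => ?_) ⟨j, Finset.mem_univ j, ?_⟩
    · split_ifs
      exacts [mul_self_nonneg _, le_rfl]
    · rw [if_pos hj]
      exact mul_self_pos.2 hqj
  rw [rhoF, if_neg hq, div_eq_iff hpos.ne', Finset.mul_sum]
  refine Finset.sum_congr rfl fun i _ => ?_
  split_ifs with hi
  · rw [hgrad i hi]
    ring
  · rw [mul_zero]

/-- φ(x) = 0 iff x is stationary for min f over Ω(x), i.e. iff
∇f(x) lies in the span of {q} ∪ {e_i : i ∈ A(x)}. -/
theorem stmt_4 {n : ℕ} (hn : 1 ≤ n)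
    (H : Matrix (Fin n) (Fin n) ℝ) (hH : H.IsSymm)
    (c q l u : Fin n → ℝ) (b : ℝ) (hlu : ∀ i, l i < u i)
    (x : Fin n → ℝ) (hx : x ∈ OmegaSet q b l u) :
    phiVec H c q l u x = 0 ↔
      ∃ (γ : ℝ) (η : Fin n → ℝ), (∀ i ∈ FSet l u x, η i = 0) ∧
        ∀ i, grad H c x i = η i + γ * q i := by
  have hφ : phiVec H c q l u x = 0 ↔ ∀ i ∈ FSet l u x, hVec H c q l u x i = 0 := by
    simp [funext_iff, phiVec]
  rw [hφ]
  constructor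
  · intro h
    exact ⟨rhoF H c q l u x, hVec H c q l u x, h, fun i => by simp [hVec]⟩
  · rintro ⟨γ, η, hη, hgrad⟩ i hi
    have hF : ∀ j ∈ FSet l u x, grad H c x j = γ * q j := fun j hj => by
      rw [hgrad, hη j hj, zero_add]
    by_cases hq : ∀ j ∈ FSet l u x, q j = 0
    · simp [hVec, hF i hi, hq i hi]
    · rw [hVec, rhoF_eq_of_grad_eq H c q l u x hq hF, hF i hi, sub_self]
end
end

section
/- For any x ∈ Ω, the free gradient φ(x) is the orthogonal projection of −∇_Ω f(x) onto the linear subspace Ω_0(x); moreover, ‖φ(x)‖² = −(∇_Ω f(x))ᵀ φ(x). -/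
noncomputable section

open Matrix
open scoped Classical

lemma dotp_eq_zero_of_nrm_le {m : Type*} [Fintype m] {w v : m → ℝ}
    (h : ∀ t : ℝ, nrm w ≤ nrm (w + t • v)) : dotp w v = 0 := by
  have hquad : ∀ t : ℝ, 0 ≤ (∑ i, v i ^ 2) * (t * t) + (2 * dotp w v) * t + 0 := by
    intro t
    have hsq := (Real.sqrt_le_sqrt_iff (Finset.sum_nonneg fun i _ => sq_nonneg _)).1 (h t)
    have hexp : ∑ i, (w + t • v) i ^ 2
        = ∑ i, w i ^ 2 + ((∑ i, v i ^ 2) * (t * t) + (2 * dotp w v) * t) := by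
      simp only [dotp, Finset.mul_sum, Finset.sum_mul, ← Finset.sum_add_distrib, Pi.add_apply,
        Pi.smul_apply, smul_eq_mul]
      exact Finset.sum_congr rfl fun i _ => by ring
    linarith
  have hdisc := discrim_le_zero hquad
  simp only [discrim] at hdisc
  nlinarith [sq_nonneg (dotp w v)]

lemma nrm_sq {m : Type*} [Fintype m] (v : m → ℝ) : nrm v ^ 2 = dotp v v := by
  rw [nrm, Real.sq_sqrt (Finset.sum_nonneg fun i _ => sq_nonneg _)]
  simp only [dotp, sq]

lemma phiVec_mem_Omega0 {n : ℕ} (H : Matrix (Fin n) (Fin n) ℝ) (c q l u x : Fin n → ℝ) :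
    phiVec H c q l u x ∈ Omega0 q l u x := by
  refine ⟨?_, fun i hi => if_neg fun hF => hF hi⟩
  have hsplit : dotp q (phiVec H c q l u x)
      = (∑ i, if i ∈ FSet l u x then q i * grad H c x i else 0)
        - rhoF H c q l u x * ∑ i, if i ∈ FSet l u x then q i * q i else 0 := by
    rw [dotp, Finset.mul_sum, ← Finset.sum_sub_distrib]
    refine Finset.sum_congr rfl fun i _ => ?_
    by_cases hi : i ∈ FSet l u x
    · simp only [phiVec, hVec, if_pos hi]
      ring
    · simp [phiVec, hi]
  rw [hsplit, rhoF]
  split_ifs with hq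
  · rw [zero_mul, sub_zero]
    refine Finset.sum_eq_zero fun i _ => ?_
    split_ifs with hi
    · rw [hq i hi, zero_mul]
    · rfl
  · push Not at hq
    obtain ⟨j, hj, hqj⟩ := hq
    have hpos : 0 < ∑ i, if i ∈ FSet l u x then q i * q i else 0 := by
      refine Finset.sum_pos' (fun i _ => ?_) ⟨j, Finset.mem_univ j, ?_⟩
      · split_ifs
        · exact mul_self_nonneg _
        · exact le_rfl
      · rw [if_pos hj]
        exact mul_self_pos.2 hqj
    rw [div_mul_cancel₀ _ hpos.ne', sub_self]

lemma dotp_phiVec_eq_dotp_grad {n : ℕ} (H : Matrix (Fin n) (Fin n) ℝ) (c q l u x : Fin n → ℝ)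
    {v : Fin n → ℝ} (hv : v ∈ Omega0 q l u x) :
    dotp (phiVec H c q l u x) v = dotp (grad H c x) v := by
  have hsplit : dotp (phiVec H c q l u x) v
      = dotp (grad H c x) v - rhoF H c q l u x * dotp q v := by
    simp only [dotp, Finset.mul_sum, ← Finset.sum_sub_distrib]
    refine Finset.sum_congr rfl fun i _ => ?_
    by_cases hi : i ∈ FSet l u x
    · simp only [phiVec, hVec, if_pos hi]
      ring
    · rw [hv.2 i (not_not.1 hi)]
      ring
  rw [hsplit, hv.1, mul_zero, sub_zero]

lemma add_smul_mem_TCone {n : ℕ} {q l u x g v : Fin n → ℝ} (hg : g ∈ TCone q l u x)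
    (hv : v ∈ Omega0 q l u x) (t : ℝ) : g + t • v ∈ TCone q l u x := by
  obtain ⟨hq, hl, hu⟩ := hg
  refine ⟨?_, fun i hi => ?_, fun i hi => ?_⟩
  · have hadd : dotp q (g + t • v) = dotp q g + t * dotp q v := by
      simp only [dotp, Finset.mul_sum, ← Finset.sum_add_distrib, Pi.add_apply, Pi.smul_apply,
        smul_eq_mul]
      exact Finset.sum_congr rfl fun i _ => by ring
    rw [hadd, hq, hv.1, mul_zero, add_zero]
  · simpa [hv.2 i (Or.inl hi)] using hl i hi
  · simpa [hv.2 i (Or.inr hi)] using hu i hi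

lemma IsProjGrad.dotp_add_grad_eq_zero {n : ℕ} {H : Matrix (Fin n) (Fin n) ℝ}
    {c q l u x g v : Fin n → ℝ} (hg : IsProjGrad H c q l u x g) (hv : v ∈ Omega0 q l u x) :
    dotp (g + grad H c x) v = 0 := by
  refine dotp_eq_zero_of_nrm_le fun t => ?_
  rw [add_right_comm]
  exact hg.2 _ (add_smul_mem_TCone hg.1 hv t)

/-- φ(x) is the orthogonal projection of −∇_Ω f(x) onto Ω₀(x),
and ‖φ(x)‖² = −(∇_Ω f(x))ᵀ φ(x). -/
theorem stmt_5 {n : ℕ} (hn : 1 ≤ n)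
    (H : Matrix (Fin n) (Fin n) ℝ) (hH : H.IsSymm)
    (c q l u : Fin n → ℝ) (b : ℝ) (hlu : ∀ i, l i < u i)
    (x : Fin n → ℝ) (hx : x ∈ OmegaSet q b l u)
    (gP : Fin n → ℝ) (hgP : IsProjGrad H c q l u x gP) :
    phiVec H c q l u x ∈ Omega0 q l u x ∧
      (∀ v ∈ Omega0 q l u x, dotp (-gP - phiVec H c q l u x) v = 0) ∧
      nrm (phiVec H c q l u x) ^ 2 = -(dotp gP (phiVec H c q l u x)) := by
  have horth : ∀ v ∈ Omega0 q l u x, dotp (-gP - phiVec H c q l u x) v = 0 := by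
    intro v hv
    have hmin := hgP.dotp_add_grad_eq_zero hv
    have hphi := dotp_phiVec_eq_dotp_grad H c q l u x hv
    simp only [dotp, Pi.add_apply, Pi.sub_apply, Pi.neg_apply, add_mul, sub_mul, neg_mul,
      Finset.sum_add_distrib, Finset.sum_sub_distrib, Finset.sum_neg_distrib] at hmin hphi ⊢
    linarith
  have hmem := phiVec_mem_Omega0 H c q l u x
  refine ⟨hmem, horth, ?_⟩
  have hself := horth _ hmem
  rw [nrm_sq]
  simp only [dotp, Pi.sub_apply, Pi.neg_apply, sub_mul, neg_mul, Finset.sum_sub_distrib,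
    Finset.sum_neg_distrib] at hself ⊢
  linarith
end
end

section
/- For any x ∈ Ω, the chopped gradient β(x) satisfies: β(x)ᵀφ(x) = 0, β(x)ᵀq = 0, and −β(x) ∈ T_Ω(x). -/
noncomputable section

open Matrix
open scoped Classical

/-- A vector whose norm is minimal along the line `a + ℝ d` is orthogonal to `d`. -/
theorem dotp_eq_zero_of_nrm_le_add_smul {m : Type*} [Fintype m] (a d : m → ℝ)
    (h : ∀ t : ℝ, nrm a ≤ nrm (a + t • d)) : dotp a d = 0 := by
  have expand (t : ℝ) : ∑ i, (a + t • d) i ^ 2 =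
      ∑ i, a i ^ 2 + (2 * dotp a d * t + dotp d d * (t * t)) := by
    simp only [dotp, Finset.mul_sum, Finset.sum_mul, ← Finset.sum_add_distrib]
    refine Finset.sum_congr rfl fun i _ => ?_
    simp only [Pi.add_apply, Pi.smul_apply, smul_eq_mul]
    ring
  have quad (t : ℝ) : 0 ≤ dotp d d * (t * t) + 2 * dotp a d * t + 0 := by
    have ht := (Real.sqrt_le_sqrt_iff (Finset.sum_nonneg fun i _ => sq_nonneg _)).1 (h t)
    rw [expand] at ht
    linarith
  have disc := discrim_le_zero quad
  unfold discrim at disc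
  nlinarith [sq_nonneg (dotp a d)]

theorem dotp_comm {m : Type*} [Fintype m] (v w : m → ℝ) : dotp v w = dotp w v := by
  simp only [dotp, mul_comm]

theorem dotp_add_left {m : Type*} [Fintype m] (v v' w : m → ℝ) :
    dotp (v + v') w = dotp v w + dotp v' w := by
  simp only [dotp, Pi.add_apply, add_mul, Finset.sum_add_distrib]

theorem dotp_neg_left {m : Type*} [Fintype m] (v w : m → ℝ) : dotp (-v) w = -dotp v w := by
  simp only [dotp, Pi.neg_apply, neg_mul, Finset.sum_neg_distrib]

theorem dotp_smul_left {m : Type*} [Fintype m] (t : ℝ) (v w : m → ℝ) :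
    dotp (t • v) w = t * dotp v w := by
  simp only [dotp, Pi.smul_apply, smul_eq_mul, mul_assoc, Finset.mul_sum]

/-- The free gradient is orthogonal to the normal of the linear constraint. -/
theorem dotp_phiVec_q {n : ℕ} (H : Matrix (Fin n) (Fin n) ℝ) (c q l u x : Fin n → ℝ) :
    dotp (phiVec H c q l u x) q = 0 := by
  by_cases h0 : ∀ i ∈ FSet l u x, q i = 0
  · refine Finset.sum_eq_zero fun i _ => ?_
    by_cases hi : i ∈ FSet l u x
    · rw [h0 i hi, mul_zero]
    · simp [phiVec, hi]
  · have hpos : 0 < ∑ i, if i ∈ FSet l u x then q i * q i else 0 := by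
      push Not at h0
      obtain ⟨j, hj, hqj⟩ := h0
      refine Finset.sum_pos' (fun i _ => ?_) ⟨j, Finset.mem_univ j, ?_⟩
      · split_ifs
        exacts [mul_self_nonneg _, le_rfl]
      · rw [if_pos hj]
        exact mul_self_pos.2 hqj
    have split : dotp (phiVec H c q l u x) q =
        (∑ i, if i ∈ FSet l u x then q i * grad H c x i else 0) -
          rhoF H c q l u x * ∑ i, if i ∈ FSet l u x then q i * q i else 0 := by
      rw [dotp, Finset.mul_sum, ← Finset.sum_sub_distrib]
      refine Finset.sum_congr rfl fun i _ => ?_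
      simp only [phiVec, hVec]
      split_ifs <;> ring
    rw [split, rhoF, if_neg h0, div_mul_cancel₀ _ hpos.ne', sub_self]

/-- The gradient and the free gradient have the same inner product with the free gradient. -/
theorem dotp_grad_phiVec {n : ℕ} (H : Matrix (Fin n) (Fin n) ℝ) (c q l u x : Fin n → ℝ) :
    dotp (grad H c x) (phiVec H c q l u x) =
      dotp (phiVec H c q l u x) (phiVec H c q l u x) := by
  have split : dotp (grad H c x) (phiVec H c q l u x) =
      dotp (phiVec H c q l u x) (phiVec H c q l u x) +
        rhoF H c q l u x * dotp (phiVec H c q l u x) q := by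
    simp only [dotp, Finset.mul_sum, ← Finset.sum_add_distrib]
    refine Finset.sum_congr rfl fun i _ => ?_
    simp only [phiVec, hVec]
    split_ifs <;> ring
  rw [split, dotp_phiVec_q, mul_zero, add_zero]

/-- The tangent cone is invariant under translation by multiples of the free gradient. -/
theorem add_smul_phiVec_mem_TCone {n : ℕ} (H : Matrix (Fin n) (Fin n) ℝ)
    (c q l u x g : Fin n → ℝ) (hg : g ∈ TCone q l u x) (t : ℝ) :
    g + t • phiVec H c q l u x ∈ TCone q l u x := by
  have vanish (i : Fin n) (hi : i ∈ ASet l u x) : phiVec H c q l u x i = 0 :=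
    if_neg fun hF => hF hi
  obtain ⟨hq, hl, hu⟩ := hg
  refine ⟨?_, fun i hi => ?_, fun i hi => ?_⟩
  · rw [dotp_comm, dotp_add_left, dotp_smul_left, dotp_phiVec_q, dotp_comm, hq]
    simp
  · simpa [vanish i (Or.inl hi)] using hl i hi
  · simpa [vanish i (Or.inr hi)] using hu i hi

/-- β(x) ⟂ φ(x), β(x) ⟂ q, and −β(x) ∈ T_Ω(x). -/
theorem stmt_7 {n : ℕ} (hn : 1 ≤ n)
    (H : Matrix (Fin n) (Fin n) ℝ) (hH : H.IsSymm)
    (c q l u : Fin n → ℝ) (b : ℝ) (hlu : ∀ i, l i < u i)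
    (x : Fin n → ℝ) (hx : x ∈ OmegaSet q b l u)
    (gP : Fin n → ℝ) (hgP : IsProjGrad H c q l u x gP) :
    dotp (betaVec H c q l u x gP) (phiVec H c q l u x) = 0 ∧
      dotp (betaVec H c q l u x gP) q = 0 ∧
      -(betaVec H c q l u x gP) ∈ TCone q l u x := by
  have beta_eq : betaVec H c q l u x gP = -(gP + phiVec H c q l u x) := by
    rw [betaVec, neg_add, sub_eq_add_neg]
  have mem : gP + phiVec H c q l u x ∈ TCone q l u x := by
    simpa using add_smul_phiVec_mem_TCone H c q l u x gP hgP.1 1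
  rw [beta_eq, dotp_neg_left, dotp_neg_left, neg_neg]
  refine ⟨?_, ?_, mem⟩
  · have orth := dotp_eq_zero_of_nrm_le_add_smul (gP + grad H c x) (phiVec H c q l u x) fun t => by
      rw [add_right_comm]
      exact hgP.2 _ (add_smul_phiVec_mem_TCone H c q l u x gP hgP.1 t)
    rw [dotp_add_left, dotp_grad_phiVec] at orth
    rw [dotp_add_left, orth, neg_zero]
  · rw [dotp_comm, mem.1, neg_zero]
end
end

section
/- Under the setup of the previous statement (A symmetric, r ≠ 0, U ∈ ℝ^{m×(m−1)} with orthonormal columns spanning Θ_0 = {z : rᵀz = 0}, UᵀAU positive definite, z̄ the minimizer of w over Θ = {z : rᵀz = s}, B = U(UᵀAU)^{-1}Uᵀ), for every z ∈ Θ: w(z) − w(z̄) ≤ (1/2)‖B‖·‖P_{Θ0}∇w(z)‖², where ‖B‖ is the spectral (operator) norm of B. -/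
noncomputable section

open Matrix
open scoped Classical

theorem dotp_eq_dotProduct {m : Type*} [Fintype m] (v w : m → ℝ) : dotp v w = v ⬝ᵥ w := rfl

theorem nrm_nonneg {m : Type*} [Fintype m] (v : m → ℝ) : 0 ≤ nrm v := Real.sqrt_nonneg _

theorem dotProduct_le_nrm_mul_nrm {m : Type*} [Fintype m] (v w : m → ℝ) :
    v ⬝ᵥ w ≤ nrm v * nrm w :=
  Real.sum_mul_le_sqrt_mul_sqrt Finset.univ v w

theorem dotProduct_mulVec_le_of_isSpectralNorm {m : Type*} [Fintype m] {M : Matrix m m ℝ} {t : ℝ}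
    (h : IsSpectralNorm M t) (v : m → ℝ) : v ⬝ᵥ M *ᵥ v ≤ t * nrm v ^ 2 :=
  calc v ⬝ᵥ M *ᵥ v ≤ nrm v * nrm (M *ᵥ v) := dotProduct_le_nrm_mul_nrm _ _
    _ ≤ nrm v * (t * nrm v) := mul_le_mul_of_nonneg_left (h.1.2 v) (nrm_nonneg v)
    _ = t * nrm v ^ 2 := by ring

/-- Orthonormal columns orthogonal to `r ≠ 0`, one fewer than the dimension, span the orthogonal
complement of `r`. -/
theorem mulVec_transpose_mulVec_of_dotProduct_eq_zero {m k : Type*} [Fintype m] [Fintype k]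
    [DecidableEq k] (hcard : Fintype.card m = Fintype.card k + 1) {U : Matrix m k ℝ}
    {r : m → ℝ} (hr : r ≠ 0) (hU : Uᵀ * U = 1) (hrU : r ᵥ* U = 0) {d : m → ℝ} (hd : r ⬝ᵥ d = 0) :
    U *ᵥ (Uᵀ *ᵥ d) = d := by
  have hrr : r ⬝ᵥ r ≠ 0 := by simpa using hr
  have hUr : Uᵀ *ᵥ r = 0 := by rw [mulVec_transpose, hrU]
  let R := replicateCol Unit r
  let L := (r ⬝ᵥ r)⁻¹ • replicateRow Unit r
  have hLR : fromRows Uᵀ L * fromCols U R = 1 := by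
    rw [fromRows_mul_fromCols, hU, ← fromBlocks_one]
    congr 1
    · ext i j
      simpa [R, mul_apply, mulVec, dotProduct] using congrFun hUr i
    · ext i j
      simpa [L, mul_apply, vecMul, dotProduct, mul_assoc, ← Finset.mul_sum] using
        Or.inr (congrFun hrU j)
    · ext i j
      simpa [L, R, mul_apply, dotProduct, mul_assoc, ← Finset.mul_sum] using inv_mul_cancel₀ hrr
  have hRL : fromCols U R * fromRows Uᵀ L = 1 :=
    (mul_eq_one_comm_of_card_eq _ _ _ (by simp [hcard])).1 hLR
  rw [fromCols_mul_fromRows] at hRL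
  have hLd : L *ᵥ d = 0 := by
    ext i
    simpa [L, mulVec, dotProduct, mul_assoc, ← Finset.mul_sum] using Or.inr hd
  simpa [add_mulVec, ← mulVec_mulVec, hLd] using congrArg (· *ᵥ d) hRL

theorem fObj_sub_fObj_sub {n : ℕ} {A : Matrix (Fin n) (Fin n) ℝ} (hA : A.IsSymm)
    (p z d : Fin n → ℝ) :
    fObj A p z - fObj A p (z - d) = d ⬝ᵥ (A *ᵥ z - p) - 1 / 2 * (d ⬝ᵥ A *ᵥ d) := by
  have hsymm : z ⬝ᵥ A *ᵥ d = d ⬝ᵥ A *ᵥ z := by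
    rw [dotProduct_mulVec, ← mulVec_transpose, hA.eq, dotProduct_comm]
  simp only [fObj, dotp_eq_dotProduct, mulVec_sub, dotProduct_sub, sub_dotProduct, hsymm,
    dotProduct_comm p d]
  ring

/-- The concave quadratic `y ↦ yᵀu - ½ yᵀHy` is bounded by its value at `H⁻¹u`. -/
theorem dotProduct_sub_half_le_of_posDef {k : Type*} [Fintype k] [DecidableEq k]
    {H : Matrix k k ℝ} (hH : H.PosDef) (y u : k → ℝ) :
    y ⬝ᵥ u - 1 / 2 * (y ⬝ᵥ H *ᵥ y) ≤ 1 / 2 * (u ⬝ᵥ H⁻¹ *ᵥ u) := by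
  have hT : Hᵀ = H := by simpa using hH.isHermitian.eq
  have hinv : H *ᵥ (H⁻¹ *ᵥ u) = u := by
    rw [mulVec_mulVec, mul_nonsing_inv _ ((isUnit_iff_isUnit_det H).1 hH.isUnit), one_mulVec]
  have hnn : 0 ≤ (y - H⁻¹ *ᵥ u) ⬝ᵥ H *ᵥ (y - H⁻¹ *ᵥ u) := by
    simpa using hH.posSemidef.dotProduct_mulVec_nonneg (y - H⁻¹ *ᵥ u)
  have hcross : (H⁻¹ *ᵥ u) ⬝ᵥ H *ᵥ y = y ⬝ᵥ u := by
    rw [dotProduct_mulVec, ← mulVec_transpose, hT, hinv, dotProduct_comm]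
  rw [mulVec_sub, hinv, sub_dotProduct, dotProduct_sub, dotProduct_sub, hcross,
    dotProduct_comm (H⁻¹ *ᵥ u)] at hnn
  linarith

/-- w(z) − w(z̄) ≤ ½‖B‖‖P_{Θ₀}∇w(z)‖² for every z ∈ Θ. -/
theorem stmt_11 {m : ℕ} (hm : 1 ≤ m)
    (A : Matrix (Fin m) (Fin m) ℝ) (hA : A.IsSymm)
    (p r : Fin m → ℝ) (hr : r ≠ 0) (s : ℝ)
    (U : Matrix (Fin m) (Fin (m - 1)) ℝ)
    (hUorth : Uᵀ * U = 1) (hUr : Matrix.vecMul r U = 0)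
    (hpos : (Uᵀ * A * U).PosDef)
    (zb : Fin m → ℝ) (hzb : dotp r zb = s)
    (hzbmin : ∀ z : Fin m → ℝ, dotp r z = s → fObj A p zb ≤ fObj A p z)
    -- nB is the spectral norm of B = U (UᵀAU)⁻¹ Uᵀ
    (nB : ℝ) (hnB : IsSpectralNorm (U * (Uᵀ * A * U)⁻¹ * Uᵀ) nB) :
    ∀ z : Fin m → ℝ, dotp r z = s →
      fObj A p z - fObj A p zb ≤
        (1 / 2) * nB * nrm ((U * Uᵀ).mulVec (A.mulVec z - p)) ^ 2 := by
  intro z hz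
  let H := Uᵀ * A * U
  let g := A *ᵥ z - p
  let y := Uᵀ *ᵥ (z - zb)
  have hd : U *ᵥ y = z - zb := by
    refine mulVec_transpose_mulVec_of_dotProduct_eq_zero ?_ hr hUorth hUr ?_
    · simp only [Fintype.card_fin]
      omega
    · rw [dotProduct_sub, ← dotp_eq_dotProduct, ← dotp_eq_dotProduct, hz, hzb, sub_self]
  have hdual (v : Fin (m - 1) → ℝ) (x : Fin m → ℝ) : (U *ᵥ v) ⬝ᵥ x = v ⬝ᵥ Uᵀ *ᵥ x := by
    rw [dotProduct_mulVec, vecMul_transpose]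
  have hexp : fObj A p z - fObj A p zb = y ⬝ᵥ Uᵀ *ᵥ g - 1 / 2 * (y ⬝ᵥ H *ᵥ y) := by
    have h := fObj_sub_fObj_sub hA p z (U *ᵥ y)
    rw [hdual, hdual, hd, sub_sub_cancel, ← hd] at h
    simpa only [H, ← mulVec_mulVec] using h
  have hB : ((U * Uᵀ) *ᵥ g) ⬝ᵥ (U * H⁻¹ * Uᵀ) *ᵥ ((U * Uᵀ) *ᵥ g) =
      (Uᵀ *ᵥ g) ⬝ᵥ H⁻¹ *ᵥ (Uᵀ *ᵥ g) := by
    have hproj (v : Fin (m - 1) → ℝ) : Uᵀ *ᵥ (U *ᵥ v) = v := by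
      rw [mulVec_mulVec, hUorth, one_mulVec]
    simp only [← mulVec_mulVec, hdual, hproj]
  have hspec := dotProduct_mulVec_le_of_isSpectralNorm hnB ((U * Uᵀ) *ᵥ g)
  have hquad := dotProduct_sub_half_le_of_posDef hpos y (Uᵀ *ᵥ g)
  change _ ≤ 1 / 2 * nB * nrm ((U * Uᵀ) *ᵥ g) ^ 2
  linarith
end
end

section
/- Let x ∈ Ω and let x̄ ∈ Ω(x) be a stationary point of the problem min f(u) subject to u ∈ Ω(x), i.e., ∇f(x̄) = Σ_{i∈A(x)} η_i e_i + γ q for some η_i, γ ∈ ℝ. Then ∇f(x̄)ᵀ(x − x̄) = 0 and f(x) − f(x̄) = (1/2)(x − x̄)ᵀH(x − x̄). -/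
noncomputable section

open Matrix
open scoped Classical

theorem dotp_mulVec_comm {n : ℕ} {H : Matrix (Fin n) (Fin n) ℝ} (hH : H.IsSymm)
    (v w : Fin n → ℝ) : dotp v (H.mulVec w) = dotp w (H.mulVec v) := by
  change v ⬝ᵥ H *ᵥ w = w ⬝ᵥ H *ᵥ v
  rw [dotProduct_mulVec, ← mulVec_transpose, hH.eq, dotProduct_comm]

/-- Exact second-order expansion of the quadratic objective. -/
theorem fObj_sub_fObj {n : ℕ} {H : Matrix (Fin n) (Fin n) ℝ} (hH : H.IsSymm)
    (c x y : Fin n → ℝ) :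
    fObj H c x - fObj H c y =
      dotp (grad H c y) (x - y) + (1 / 2) * dotp (x - y) (H.mulVec (x - y)) := by
  have hsymm := dotp_mulVec_comm hH x y
  have hcomm (v w : Fin n → ℝ) : (H *ᵥ v) ⬝ᵥ w = w ⬝ᵥ H *ᵥ v := dotProduct_comm _ _
  unfold fObj grad
  change x ⬝ᵥ H *ᵥ y = y ⬝ᵥ H *ᵥ x at hsymm
  change (1 / 2) * (x ⬝ᵥ H *ᵥ x) - c ⬝ᵥ x - ((1 / 2) * (y ⬝ᵥ H *ᵥ y) - c ⬝ᵥ y) =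
    (H *ᵥ y - c) ⬝ᵥ (x - y) + (1 / 2) * ((x - y) ⬝ᵥ H *ᵥ (x - y))
  simp only [mulVec_sub, sub_dotProduct, dotProduct_sub, hcomm]
  linarith

/-- for a stationary point x̄ of min f over Ω(x),
∇f(x̄)ᵀ(x − x̄) = 0 and f(x) − f(x̄) = ½(x − x̄)ᵀH(x − x̄). -/
theorem stmt_12 {n : ℕ} (hn : 1 ≤ n)
    (H : Matrix (Fin n) (Fin n) ℝ) (hH : H.IsSymm)
    (c q l u : Fin n → ℝ) (b : ℝ) (hlu : ∀ i, l i < u i)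
    (x : Fin n → ℝ) (hx : x ∈ OmegaSet q b l u)
    (xb : Fin n → ℝ) (hxb : xb ∈ OmegaFace q b l u x)
    -- ∇f(x̄) = Σ_{i∈A(x)} η_i e_i + γ q
    (γ : ℝ) (η : Fin n → ℝ) (hη : ∀ i ∈ FSet l u x, η i = 0)
    (hkkt : ∀ i, grad H c xb i = η i + γ * q i) :
    dotp (grad H c xb) (x - xb) = 0 ∧
      fObj H c x - fObj H c xb = (1 / 2) * dotp (x - xb) (H.mulVec (x - xb)) := by
  have hgrad : dotp (grad H c xb) (x - xb) = 0 := by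
    have hterm (i : Fin n) :
        grad H c xb i * (x - xb) i = γ * (q i * x i) - γ * (q i * xb i) := by
      rw [hkkt i, Pi.sub_apply]
      by_cases hi : i ∈ ASet l u x
      · rw [hxb.2 i hi]
        ring
      · rw [hη i hi]
        ring
    have hqx : ∑ i, q i * x i = b := hx.1
    have hqxb : ∑ i, q i * xb i = b := hxb.1
    simp only [dotp, hterm, Finset.sum_sub_distrib, ← Finset.mul_sum, hqx, hqxb, sub_self]
  exact ⟨hgrad, by rw [fObj_sub_fObj hH, hgrad, zero_add]⟩
end
end

section
/- Let H ∈ ℝ^{n×n} be symmetric, q ∈ ℝⁿ with q ≠ 0, and F ⊆ {1,…,n} with q_F ≠ 0. Let V ∈ ℝ^{n×(n−1)} have orthonormal columns spanning {q}^⊥ and H_q = VᵀHV. Then for every nonzero w ∈ ℝ^{|F|} with q_Fᵀw = 0, the Rayleigh quotient satisfies (wᵀH_{FF}w)/(wᵀw) ≥ ζ_min(H_q); equivalently, if W ∈ ℝ^{|F|×(|F|−1)} has orthonormal columns spanning {q_F}^⊥ in ℝ^{|F|}, then ζ_min(WᵀH_{FF}W) ≥ ζ_min(H_q). -/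
noncomputable section

open Matrix
open scoped Classical

/-- The smallest eigenvalue of a symmetric matrix bounds its quadratic form from below. -/
theorem IsSmallestEigenvalue.mul_dotProduct_self_le {m : Type*} [Fintype m]
    {M : Matrix m m ℝ} (hM : M.IsSymm) {ζ : ℝ} (hζ : IsSmallestEigenvalue M ζ) (y : m → ℝ) :
    ζ * (y ⬝ᵥ y) ≤ y ⬝ᵥ M *ᵥ y := by
  have hA : (M - ζ • (1 : Matrix m m ℝ)).IsHermitian := by
    rw [IsHermitian, conjTranspose_eq_transpose_of_trivial, transpose_sub, transpose_smul,
      transpose_one, hM.eq]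
  have hpos : (M - ζ • (1 : Matrix m m ℝ)).PosSemidef := by
    rw [hA.posSemidef_iff_eigenvalues_nonneg]
    intro i
    have hv := hA.mulVec_eigenvectorBasis i
    have hne : ((hA.eigenvectorBasis i : EuclideanSpace ℝ m) : m → ℝ) ≠ 0 := by
      intro h
      apply hA.eigenvectorBasis.orthonormal.ne_zero i
      ext j
      exact congrFun h j
    rw [sub_mulVec, smul_mulVec, one_mulVec, sub_eq_iff_eq_add, ← add_smul] at hv
    have := hζ.2 _ _ hne hv
    simpa using this
  have h := hpos.dotProduct_mulVec_nonneg y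
  rw [star_trivial, sub_mulVec, smul_mulVec, one_mulVec, dotProduct_sub, dotProduct_smul,
    smul_eq_mul] at h
  linarith

theorem IsSmallestEigenvalue.exists_dotProduct_mulVec_eq {m : Type*} [Fintype m]
    {M : Matrix m m ℝ} {ζ : ℝ} (hζ : IsSmallestEigenvalue M ζ) :
    ∃ v : m → ℝ, v ≠ 0 ∧ v ⬝ᵥ M *ᵥ v = ζ * (v ⬝ᵥ v) := by
  obtain ⟨⟨v, hv0, hv⟩, -⟩ := hζ
  exact ⟨v, hv0, by rw [hv, dotProduct_smul, smul_eq_mul]⟩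

theorem dotProduct_mulVec_of_transpose_mul_self {m k : Type*} [Fintype m] [Fintype k] [DecidableEq k]
    {V : Matrix m k ℝ} (hV : Vᵀ * V = 1) (y : k → ℝ) : V *ᵥ y ⬝ᵥ V *ᵥ y = y ⬝ᵥ y := by
  rw [dotProduct_mulVec, ← mulVec_transpose, mulVec_mulVec, hV, one_mulVec]

theorem dotProduct_transpose_mul_mul_mulVec {m k : Type*} [Fintype m] [Fintype k]
    (V : Matrix m k ℝ) (M : Matrix m m ℝ) (y : k → ℝ) :
    y ⬝ᵥ (Vᵀ * M * V) *ᵥ y = V *ᵥ y ⬝ᵥ M *ᵥ (V *ᵥ y) := by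
  rw [← mulVec_mulVec, ← mulVec_mulVec, dotProduct_mulVec, vecMul_transpose]

theorem dotProduct_self_pos_of_ne_zero {m : Type*} [Fintype m] {v : m → ℝ} (hv : v ≠ 0) :
    0 < v ⬝ᵥ v := by
  simpa using dotProduct_self_star_pos_iff.2 hv

/-- If the `n - 1` orthonormal columns of `V` are orthogonal to `q ≠ 0`, then they span the
orthogonal complement of `q`. -/
theorem exists_mulVec_eq_of_dotProduct_eq_zero {n : ℕ} {q : Fin n → ℝ} (hq : q ≠ 0)
    {V : Matrix (Fin n) (Fin (n - 1)) ℝ} (hV : Vᵀ * V = 1) (hVq : q ᵥ* V = 0)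
    {x : Fin n → ℝ} (hx : q ⬝ᵥ x = 0) : ∃ y, V *ᵥ y = x := by
  let f : Module.Dual ℝ (Fin n → ℝ) := dotProductBilin ℝ ℝ q
  have hf : f ≠ 0 := fun h => hq (dotProduct_self_eq_zero.1 (LinearMap.congr_fun h q))
  have hinj : Function.Injective V.mulVecLin := by
    intro a b hab
    have := congrArg (Vᵀ *ᵥ ·) hab
    simpa [mulVec_mulVec, hV] using this
  have hle : LinearMap.range V.mulVecLin ≤ LinearMap.ker f := by
    rintro _ ⟨y, rfl⟩
    change q ⬝ᵥ V *ᵥ y = 0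
    rw [dotProduct_mulVec, hVq, zero_dotProduct]
  have hrank : Module.finrank ℝ (LinearMap.range V.mulVecLin) =
      Module.finrank ℝ (LinearMap.ker f) := by
    have h := Module.Dual.finrank_ker_add_one_of_ne_zero hf
    rw [LinearMap.finrank_range_of_inj hinj]
    simp only [Module.finrank_fin_fun] at h ⊢
    omega
  have hmem : x ∈ LinearMap.ker f := hx
  rw [← Submodule.eq_of_le_of_finrank_eq hle hrank] at hmem
  exact hmem

theorem extend_dotProduct {n : ℕ} (F : Finset (Fin n)) (w : {i // i ∈ F} → ℝ) (z : Fin n → ℝ) :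
    Function.extend Subtype.val w 0 ⬝ᵥ z = w ⬝ᵥ fun i => z i := by
  have hsupp : ∀ i ∉ F, Function.extend (Subtype.val : {i // i ∈ F} → Fin n) w 0 i * z i = 0 := by
    intro i hi
    rw [Function.extend_apply' _ _ _ (by rintro ⟨a, rfl⟩; exact hi a.2), Pi.zero_apply, zero_mul]
  rw [dotProduct, ← Finset.sum_subset F.subset_univ fun i _ hi => hsupp i hi, ← F.sum_coe_sort]
  simp [dotProduct]

/-- The bound `ζ ‖w‖² ≤ wᵀ H_FF w` on the orthogonal complement of `q_F`. -/
theorem mul_dotProduct_self_le_submatrix {n : ℕ} {H : Matrix (Fin n) (Fin n) ℝ} (hH : H.IsSymm)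
    {q : Fin n → ℝ} (hq : q ≠ 0) {V : Matrix (Fin n) (Fin (n - 1)) ℝ} (hV : Vᵀ * V = 1)
    (hVq : q ᵥ* V = 0) {ζ : ℝ} (hζ : IsSmallestEigenvalue (Vᵀ * H * V) ζ) {F : Finset (Fin n)}
    {w : {i // i ∈ F} → ℝ} (hw : (fun i : {i // i ∈ F} => q i) ⬝ᵥ w = 0) :
    ζ * (w ⬝ᵥ w) ≤ w ⬝ᵥ H.submatrix (Subtype.val : {i // i ∈ F} → Fin n) Subtype.val *ᵥ w := by
  have hx : q ⬝ᵥ Function.extend Subtype.val w 0 = 0 := by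
    rw [dotProduct_comm, extend_dotProduct, dotProduct_comm, hw]
  obtain ⟨y, hy⟩ := exists_mulVec_eq_of_dotProduct_eq_zero hq hV hVq hx
  have hsymm : (Vᵀ * H * V).IsSymm := by
    rw [IsSymm, transpose_mul, transpose_mul, transpose_transpose, hH.eq, Matrix.mul_assoc]
  have h := hζ.mul_dotProduct_self_le hsymm y
  rw [dotProduct_transpose_mul_mul_mulVec, ← dotProduct_mulVec_of_transpose_mul_self hV, hy,
    extend_dotProduct, extend_dotProduct] at h
  convert h using 2
  · simp
  · ext i
    rw [mulVec, mulVec, dotProduct_comm (H i), extend_dotProduct, dotProduct_comm]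
    rfl

/-- Rayleigh-quotient bound: for w ≠ 0 supported on F with q_Fᵀw = 0,
(wᵀH_FF w)/(wᵀw) ≥ ζ_min(H_q); equivalently ζ_min(WᵀH_FF W) ≥ ζ_min(H_q). -/
theorem stmt_13 {n : ℕ} (hn : 2 ≤ n)
    (H : Matrix (Fin n) (Fin n) ℝ) (hH : H.IsSymm)
    (q : Fin n → ℝ) (hq : q ≠ 0)
    (F : Finset (Fin n)) (hqF : ∃ i ∈ F, q i ≠ 0)
    -- V has orthonormal columns spanning {q}ᗮ, H_q = VᵀHV
    (V : Matrix (Fin n) (Fin (n - 1)) ℝ)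
    (hVorth : Vᵀ * V = 1) (hVq : Matrix.vecMul q V = 0)
    (ζ : ℝ) (hζ : IsSmallestEigenvalue (Vᵀ * H * V) ζ)
    -- W has orthonormal columns spanning {q_F}ᗮ in ℝ^{|F|}
    (W : Matrix {i // i ∈ F} (Fin (F.card - 1)) ℝ)
    (hWorth : Wᵀ * W = 1)
    (hWq : Matrix.vecMul (fun i : {i // i ∈ F} => q i) W = 0)
    (ζW : ℝ)
    (hζW : IsSmallestEigenvalue
      (Wᵀ * H.submatrix (Subtype.val : {i // i ∈ F} → Fin n) Subtype.val * W) ζW) :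
    (∀ w : {i // i ∈ F} → ℝ, w ≠ 0 → dotp (fun i : {i // i ∈ F} => q i) w = 0 →
        ζ ≤ dotp w ((H.submatrix (Subtype.val : {i // i ∈ F} → Fin n) Subtype.val).mulVec w) /
          dotp w w) ∧
      ζ ≤ ζW := by
  have hbound : ∀ w : {i // i ∈ F} → ℝ, (fun i : {i // i ∈ F} => q i) ⬝ᵥ w = 0 →
      ζ * (w ⬝ᵥ w) ≤ w ⬝ᵥ H.submatrix (Subtype.val : {i // i ∈ F} → Fin n) Subtype.val *ᵥ w :=
    fun w hw => mul_dotProduct_self_le_submatrix hH hq hVorth hVq hζ hw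
  refine ⟨fun w hw0 hw => ?_, ?_⟩
  · simp only [dotp_eq_dotProduct] at hw ⊢
    rw [le_div_iff₀ (dotProduct_self_pos_of_ne_zero hw0)]
    exact hbound w hw
  · obtain ⟨v, hv0, hv⟩ := hζW.exists_dotProduct_mulVec_eq
    have h := hbound (W *ᵥ v) (by rw [dotProduct_mulVec, hWq, zero_dotProduct])
    rw [← dotProduct_transpose_mul_mul_mulVec,
      dotProduct_mulVec_of_transpose_mul_self hWorth] at h
    exact le_of_mul_le_mul_right (h.trans_eq hv) (dotProduct_self_pos_of_ne_zero hv0)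
end
end
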